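/- Let f = (1/2)·1_{[−1,1]} be the uniform density on [−1,1] and let π be a permutation of {1,…,n+1}. Let S be the set of functions k : Φ⁺ → ℤ such that k(i,j) ≥ 0 for all (i,j) ∈ Φ⁺, k satisfies the Shi condition, and k(i,j) = 0 for all (i,j) ∈ I_π. Then S is finite and P(f,π) = |S| / (2^n · n!). -/

import Mathlib

open MeasureTheory

noncomputable section

/-- Walk positions: `walk n x i = x 0 + ⋯ + x (i-1)` (so `walk n x 0 = 0`). -/
def walk (n : ℕ) (x : Fin n → ℝ) (i : Fin (n + 1)) : ℝ :=
  ∑ j : Fin n, if (j : ℕ) < (i : ℕ) then x j else 0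

/-- The region of step tuples generating the ordinal pattern `π`. -/
def D (n : ℕ) (π : Equiv.Perm (Fin (n + 1))) : Set (Fin n → ℝ) :=
  {x | (∀ i j : Fin (n + 1), i ≠ j → walk n x i ≠ walk n x j) ∧
       (∀ i j : Fin (n + 1), walk n x i < walk n x j ↔ π i < π j)}

/-- The matrix `L_π`. -/
def L (n : ℕ) (π : Equiv.Perm (Fin (n + 1))) : Matrix (Fin n) (Fin n) ℝ :=
  fun i j =>
    if (π i.castSucc : ℕ) ≤ (j : ℕ) ∧ (j : ℕ) < (π i.succ : ℕ) then 1
    else if (π i.succ : ℕ) ≤ (j : ℕ) ∧ (j : ℕ) < (π i.castSucc : ℕ) then -1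
    else 0

/-- Partial sum `x i + x (i+1) + ⋯ + x (j-1)`. -/
def psum (n : ℕ) (x : Fin n → ℝ) (i j : Fin (n + 1)) : ℝ :=
  ∑ k : Fin n, if (i : ℕ) ≤ (k : ℕ) ∧ (k : ℕ) < (j : ℕ) then x k else 0

/-- The level count `lev(π)_j`. -/
def lev (n : ℕ) (π : Equiv.Perm (Fin (n + 1))) (j : Fin n) : ℕ :=
  (Finset.univ.filter fun i : Fin n =>
    ((π i.castSucc : ℕ) ≤ (j : ℕ) ∧ (j : ℕ) < (π i.succ : ℕ)) ∨
    ((π i.succ : ℕ) ≤ (j : ℕ) ∧ (j : ℕ) < (π i.castSucc : ℕ))).card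

/-- The polytope of steps `P_π`. -/
def Ppoly (n : ℕ) (π : Equiv.Perm (Fin (n + 1))) : Set (Fin n → ℝ) :=
  {x | (∀ i, 0 ≤ x i) ∧ ∀ i : Fin n,
    psum n x (min (π i.castSucc) (π i.succ)) (max (π i.castSucc) (π i.succ)) ≤ 1}

/-- The set of positive roots, identified with pairs `i < j`. -/
def PosRoot (n : ℕ) := {p : Fin (n + 1) × Fin (n + 1) // p.1 < p.2}

/-- The Shi condition for an alcove address. -/
def Shi (n : ℕ) (k : PosRoot n → ℤ) : Prop :=
  ∀ (i t j : Fin (n + 1)) (hit : i < t) (htj : t < j),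
    k ⟨(i, t), hit⟩ + k ⟨(t, j), htj⟩ ≤ k ⟨(i, j), hit.trans htj⟩ ∧
    k ⟨(i, j), hit.trans htj⟩ ≤ k ⟨(i, t), hit⟩ + k ⟨(t, j), htj⟩ + 1

/-- The alcove with address `k`, in step coordinates. -/
def alcove (n : ℕ) (k : PosRoot n → ℤ) : Set (Fin n → ℝ) :=
  {x | ∀ p : PosRoot n,
    (k p : ℝ) < psum n x p.1.1 p.1.2 ∧ psum n x p.1.1 p.1.2 < (k p : ℝ) + 1}

/-- The root ideal `I_π`. -/
def rootIdeal (n : ℕ) (π : Equiv.Perm (Fin (n + 1))) : Set (PosRoot n) :=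
  {p | ∃ c : Fin n,
    min (π c.castSucc : ℕ) (π c.succ : ℕ) ≤ (p.1.1 : ℕ) ∧
    (p.1.2 : ℕ) ≤ max (π c.castSucc : ℕ) (π c.succ : ℕ)}

/-- The level count matrix `lev(π)_{i,j}`. -/
def lev2 (n : ℕ) (π : Equiv.Perm (Fin (n + 1))) (i j : Fin n) : ℕ :=
  (Finset.univ.filter fun k : Fin n =>
    ((π k.castSucc : ℕ) ≤ (i : ℕ) ∧ (π k.castSucc : ℕ) ≤ (j : ℕ) ∧
     (i : ℕ) < (π k.succ : ℕ) ∧ (j : ℕ) < (π k.succ : ℕ)) ∨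
    ((π k.succ : ℕ) ≤ (i : ℕ) ∧ (π k.succ : ℕ) ≤ (j : ℕ) ∧
     (i : ℕ) < (π k.castSucc : ℕ) ∧ (j : ℕ) < (π k.castSucc : ℕ))).card

/-- The set of nonnegative Shi addresses vanishing on the root ideal of `π`. -/
def addrSet (n : ℕ) (π : Equiv.Perm (Fin (n + 1))) : Set (PosRoot n → ℤ) :=
  {k | (∀ p, 0 ≤ k p) ∧ Shi n k ∧ ∀ p ∈ rootIdeal n π, k p = 0}

/-- Extend a point of `ℝⁿ` by a zeroth coordinate equal to `0`. -/
def extendZero {n : ℕ} (y : Fin n → ℝ) : Fin (n + 1) → ℝ := Fin.cons 0 y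

@[simp] lemma extendZero_zero {n : ℕ} (y : Fin n → ℝ) : extendZero y 0 = 0 := rfl

@[simp] lemma extendZero_succ {n : ℕ} (y : Fin n → ℝ) (i : Fin n) :
    extendZero y i.succ = y i := rfl

lemma continuous_extendZero {n : ℕ} (i : Fin (n + 1)) :
    Continuous fun y : Fin n → ℝ => extendZero y i := by
  refine Fin.cases ?_ (fun j => ?_) i
  · simpa using continuous_const
  · simpa using continuous_apply j

lemma walk_zero {n : ℕ} (x : Fin n → ℝ) : walk n x 0 = 0 := by simp [walk]

lemma walk_succ {n : ℕ} (x : Fin n → ℝ) (i : Fin n) :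
    walk n x i.succ = walk n x i.castSucc + x i := by
  have h : ∀ j : Fin n, (if (j : ℕ) < (i.succ : ℕ) then x j else 0) =
      (if (j : ℕ) < (i.castSucc : ℕ) then x j else 0) + if j = i then x j else 0 := by
    intro j
    rcases lt_trichotomy (j : ℕ) (i : ℕ) with h | h | h
    · have : j ≠ i := fun e => by simp [e] at h
      simp [h, this, Nat.lt_succ_of_lt h]
    · have : j = i := Fin.ext h
      simp [this]
    · have h1 : j ≠ i := fun e => by simp [e] at h
      have h2 : ¬ (j : ℕ) < i + 1 := by omega
      have h3 : ¬ (j : ℕ) < i := by omega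
      simp [h1, -Fin.val_fin_lt, h3, h2]
  unfold walk
  rw [Finset.sum_congr rfl fun j _ => h j, Finset.sum_add_distrib]
  simp

lemma walk_sub {n : ℕ} (g : Fin (n + 1) → ℝ) (i : Fin (n + 1)) :
    walk n (fun j => g j.succ - g j.castSucc) i = g i - g 0 := by
  induction i using Fin.induction with
  | zero => simp [walk_zero]
  | succ i ih => rw [walk_succ, ih]; ring

/-- The matrix taking the sorted positions (relative to the lowest) to the steps of a walk
with ordinal pattern `π`. -/
def stepMatrix (n : ℕ) (π : Equiv.Perm (Fin (n + 1))) : Matrix (Fin n) (Fin n) ℤ :=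
  fun i j => (if π i.succ = j.succ then 1 else 0) - if π i.castSucc = j.succ then 1 else 0

/-- The inverse of `stepMatrix n π`. -/
def sortedMatrix (n : ℕ) (π : Equiv.Perm (Fin (n + 1))) : Matrix (Fin n) (Fin n) ℤ :=
  fun j i => (if (i : ℕ) < (π.symm j.succ : ℕ) then 1 else 0) -
    if (i : ℕ) < (π.symm 0 : ℕ) then 1 else 0

lemma extendZero_eq_sum {n : ℕ} (y : Fin n → ℝ) (i : Fin (n + 1)) :
    extendZero y i = ∑ j : Fin n, (if i = j.succ then 1 else 0) * y j := by
  refine Fin.cases ?_ (fun j => ?_) i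
  · simp [(Fin.succ_ne_zero _).symm]
  · simp

/-- The steps of the walk with ordinal pattern `π` and sorted positions `y`. -/
def stepMap (n : ℕ) (π : Equiv.Perm (Fin (n + 1))) : (Fin n → ℝ) →ₗ[ℝ] (Fin n → ℝ) :=
  Matrix.toLin' ((stepMatrix n π).map (Int.castRingHom ℝ))

lemma stepMap_apply {n : ℕ} (π : Equiv.Perm (Fin (n + 1))) (y : Fin n → ℝ) :
    stepMap n π y = fun i => extendZero y (π i.succ) - extendZero y (π i.castSucc) := by
  ext i
  simp only [stepMap, Matrix.toLin'_apply, Matrix.mulVec, dotProduct, Matrix.map_apply,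
    stepMatrix, extendZero_eq_sum y, ← Finset.sum_sub_distrib, ← sub_mul]
  refine Finset.sum_congr rfl fun j _ => ?_
  simp

lemma walk_stepMap {n : ℕ} (π : Equiv.Perm (Fin (n + 1))) (y : Fin n → ℝ) (i : Fin (n + 1)) :
    walk n (stepMap n π y) i = extendZero y (π i) - extendZero y (π 0) := by
  rw [stepMap_apply]
  exact walk_sub (fun i => extendZero y (π i)) i

lemma sortedMatrix_mul_stepMatrix (n : ℕ) (π : Equiv.Perm (Fin (n + 1))) :
    sortedMatrix n π * stepMatrix n π = 1 := by
  have hinj : Function.Injective (fun M : Matrix (Fin n) (Fin n) ℤ =>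
      M.map (Int.castRingHom ℝ)) := Matrix.map_injective Int.cast_injective
  apply hinj
  simp only [Matrix.map_mul]
  rw [Matrix.map_one _ (map_zero _) (map_one _)]
  apply Matrix.toLin'.injective
  rw [Matrix.toLin'_mul, Matrix.toLin'_one]
  refine LinearMap.ext fun y => ?_
  change Matrix.toLin' _ (stepMap n π y) = y
  have key : ∀ x : Fin n → ℝ, Matrix.toLin' ((sortedMatrix n π).map (Int.castRingHom ℝ)) x =
      fun j => walk n x (π.symm j.succ) - walk n x (π.symm 0) := by
    intro x
    ext j
    simp only [Matrix.toLin'_apply, Matrix.mulVec, dotProduct, Matrix.map_apply,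
      sortedMatrix, walk, ← Finset.sum_sub_distrib]
    refine Finset.sum_congr rfl fun i _ => ?_
    simp [sub_mul]
  rw [key]
  ext j
  simp [walk_stepMap]

lemma abs_det_stepMap (n : ℕ) (π : Equiv.Perm (Fin (n + 1))) :
    |LinearMap.det (stepMap n π)| = 1 := by
  have h : (stepMatrix n π).det = 1 ∨ (stepMatrix n π).det = -1 := by
    apply Int.isUnit_iff.mp
    have := congrArg Matrix.det (sortedMatrix_mul_stepMatrix n π)
    rw [Matrix.det_mul, Matrix.det_one] at this
    exact IsUnit.of_mul_eq_one_right _ this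
  have h2 : LinearMap.det (stepMap n π) = ((stepMatrix n π).det : ℝ) := by
    rw [stepMap, LinearMap.det_toLin']
    exact ((Int.castRingHom ℝ).map_det _).symm
  rw [h2]
  rcases h with h | h <;> simp [h]

lemma volume_preimage_stepMap (n : ℕ) (π : Equiv.Perm (Fin (n + 1))) (s : Set (Fin n → ℝ)) :
    volume (stepMap n π ⁻¹' s) = volume s := by
  have h := abs_det_stepMap n π
  have h0 : LinearMap.det (stepMap n π) ≠ 0 := fun e => by simp [e] at h
  rw [Measure.addHaar_preimage_linearMap _ h0, abs_inv, h]
  simp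

lemma volume_extendZero_sub_eq {n : ℕ} {i j : Fin (n + 1)} (hij : i < j) (c : ℝ) :
    volume {y : Fin n → ℝ | extendZero y j - extendZero y i = c} = 0 := by
  obtain ⟨j, rfl⟩ := Fin.exists_succ_eq.mpr (Fin.ne_zero_of_lt hij)
  let ℓ : (Fin n → ℝ) →ₗ[ℝ] ℝ :=
    { toFun := fun y => extendZero y j.succ - extendZero y i
      map_add' := fun y z => by
        simp only [extendZero_eq_sum, Pi.add_apply, mul_add, Finset.sum_add_distrib]; ring
      map_smul' := fun a y => by
        simp only [extendZero_eq_sum, Pi.smul_apply, smul_eq_mul, RingHom.id_apply, mul_sub,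
          Finset.mul_sum]
        congr 1 <;> exact Finset.sum_congr rfl fun _ _ => by ring }
  have hℓ : ℓ (Pi.single j 1) = 1 := by
    have : extendZero (Pi.single j (1 : ℝ)) i = 0 := by
      revert hij
      refine Fin.cases (fun _ => rfl) (fun k hk => ?_) i
      have : k ≠ j := fun e => by simp [e] at hk
      simp [this]
    change extendZero _ j.succ - extendZero _ i = 1
    simp [this]
  have hker : volume (LinearMap.ker ℓ : Set (Fin n → ℝ)) = 0 := by
    apply Measure.addHaar_submodule
    intro h
    have : Pi.single j 1 ∈ LinearMap.ker ℓ := h ▸ Submodule.mem_top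
    rw [LinearMap.mem_ker, hℓ] at this
    exact one_ne_zero this
  have : {y : Fin n → ℝ | extendZero y j.succ - extendZero y i = c} =
      (fun y => y + -(c • Pi.single j 1)) ⁻¹' (LinearMap.ker ℓ : Set (Fin n → ℝ)) := by
    ext y
    simp only [Set.mem_ofPred_eq, Set.mem_preimage, SetLike.mem_coe, LinearMap.mem_ker, map_add,
      map_neg, map_smul, hℓ]
    change _ ↔ (extendZero y j.succ - extendZero y i) + _ = 0
    simp [add_neg_eq_zero]
  rw [this, measure_preimage_add_right, hker]

/-- Points having two coordinates (including the zeroth one) with integer difference. -/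
def integralWalls (n : ℕ) : Set (Fin n → ℝ) :=
  {y | ∃ i j : Fin (n + 1), i < j ∧ ∃ c : ℤ, extendZero y j - extendZero y i = c}

lemma volume_integralWalls (n : ℕ) : volume (integralWalls n) = 0 := by
  have : integralWalls n = ⋃ (i : Fin (n + 1)) (j : Fin (n + 1)) (_ : i < j) (c : ℤ),
      {y : Fin n → ℝ | extendZero y j - extendZero y i = c} := by
    ext y; simp [integralWalls]
  rw [this]
  simp only [measure_iUnion_null_iff]
  exact fun i j hij c => volume_extendZero_sub_eq hij c

/-- The simplex of points of the open unit cube whose coordinates are ordered by `σ`. -/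
def orderSimplex (n : ℕ) (σ : Equiv.Perm (Fin n)) : Set (Fin n → ℝ) :=
  {u | (∀ i, 0 < u i ∧ u i < 1) ∧ ∀ i j, σ i < σ j → u i < u j}

lemma measurableSet_orderSimplex (n : ℕ) (σ : Equiv.Perm (Fin n)) :
    MeasurableSet (orderSimplex n σ) := by
  apply IsOpen.measurableSet
  simp only [orderSimplex, Set.ofPred_and, Set.ofPred_forall]
  refine IsOpen.inter (isOpen_iInter_of_finite fun i => IsOpen.inter ?_ ?_)
    (isOpen_iInter_of_finite fun i => isOpen_iInter_of_finite fun j =>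
      isOpen_iInter_of_finite fun _ => ?_)
  · exact isOpen_lt continuous_const (continuous_apply i)
  · exact isOpen_lt (continuous_apply i) continuous_const
  · exact isOpen_lt (continuous_apply i) (continuous_apply j)

lemma volume_orderSimplex_eq (n : ℕ) (σ : Equiv.Perm (Fin n)) :
    volume (orderSimplex n σ) = volume (orderSimplex n 1) := by
  have h := (volume_measurePreserving_piCongrLeft (fun _ : Fin n => ℝ) σ).measure_preimage_equiv
    (orderSimplex n 1)
  rw [← h]
  congr 1
  ext u
  have hu : ∀ i, MeasurableEquiv.piCongrLeft (fun _ : Fin n => ℝ) σ u (σ i) = u i := fun i =>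
    MeasurableEquiv.piCongrLeft_apply_apply ..
  simp only [orderSimplex, Set.mem_ofPred_eq, Set.mem_preimage, Equiv.Perm.coe_one, id]
  constructor
  · rintro ⟨h1, h2⟩
    refine ⟨fun i => ?_, fun i j hij => ?_⟩ <;> obtain ⟨i, rfl⟩ := σ.surjective i
    · simpa only [hu] using h1 i
    · obtain ⟨j, rfl⟩ := σ.surjective j
      simpa only [hu] using h2 i j hij
  · rintro ⟨h1, h2⟩
    refine ⟨fun i => ?_, fun i j hij => ?_⟩
    · simpa only [hu] using h1 (σ i)
    · simpa only [hu] using h2 (σ i) (σ j) hij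

lemma exists_perm_lt_iff {n : ℕ} (r : Fin n → Fin n → Prop) (irr : ∀ i, ¬ r i i)
    (tr : ∀ i j k, r i j → r j k → r i k) (tot : ∀ i j, i ≠ j → r i j ∨ r j i) :
    ∃ σ : Equiv.Perm (Fin n), ∀ i j, σ i < σ j ↔ r i j := by
  classical
  let rank : Fin n → Fin n := fun i => ⟨(Finset.univ.filter fun j => r j i).card, by
    have : (Finset.univ.filter fun j => r j i) ⊂ Finset.univ :=
      Finset.filter_ssubset.mpr ⟨i, Finset.mem_univ _, irr i⟩
    simpa using Finset.card_lt_card this⟩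
  have mono : ∀ i j, r i j → rank i < rank j := by
    intro i j hij
    change (Finset.univ.filter fun l => r l i).card < (Finset.univ.filter fun l => r l j).card
    refine Finset.card_lt_card (Finset.ssubset_iff_of_subset ?_ |>.mpr ⟨i, ?_, ?_⟩)
    · intro k
      simpa using fun hk => tr k i j hk hij
    · simpa using hij
    · simpa using irr i
  have inj : Function.Injective rank := by
    intro i j hij
    by_contra hne
    rcases tot i j hne with h | h
    · exact (mono _ _ h).ne hij
    · exact (mono _ _ h).ne hij.symm
  refine ⟨Equiv.ofBijective rank (Finite.injective_iff_bijective.mp inj), fun i j => ?_⟩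
  simp only [Equiv.ofBijective_apply]
  refine ⟨fun h => ?_, mono i j⟩
  rcases tot i j (fun e => by simp [e] at h) with h' | h'
  · exact h'
  · exact absurd (mono _ _ h') h.asymm

lemma volume_orderSimplex (n : ℕ) (σ : Equiv.Perm (Fin n)) :
    volume (orderSimplex n σ) = (n.factorial : ENNReal)⁻¹ := by
  have hcube : volume (Set.univ.pi fun _ : Fin n => Set.Ioo (0 : ℝ) 1) = 1 := by
    rw [Real.volume_pi_Ioo]; simp
  have hdisj : Pairwise (Function.onFun Disjoint (orderSimplex n)) := by
    intro σ τ hne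
    refine Set.disjoint_left.mpr fun u hσ hτ => hne ?_
    have lt_iff : ∀ ρ : Equiv.Perm (Fin n), u ∈ orderSimplex n ρ →
        ∀ i j, ρ i < ρ j ↔ u i < u j := by
      intro ρ h i j
      refine ⟨h.2 i j, fun hu => ?_⟩
      rcases lt_trichotomy (ρ i) (ρ j) with h1 | h1 | h1
      · exact h1
      · rw [ρ.injective h1] at hu; exact absurd hu (lt_irrefl _)
      · exact absurd (h.2 _ _ h1) hu.asymm
    have hmono : StrictMono (τ ∘ σ.symm) := by
      intro a b hab
      have := (lt_iff τ hτ (σ.symm a) (σ.symm b)).trans (lt_iff σ hσ _ _).symm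
      simpa [hab] using this
    have hid : ⇑(σ.symm.trans τ) = id := by
      have : StrictMono (σ.symm.trans τ) := hmono
      have h2 := Subsingleton.elim
        (this.orderIsoOfSurjective _ (σ.symm.trans τ).surjective) (OrderIso.refl (Fin n))
      ext a
      exact congrArg Fin.val (congrArg (fun e : Fin n ≃o Fin n => e a) h2)
    ext a
    have := congrFun hid (σ a)
    simp at this
    rw [this]
  have hunion : volume (⋃ σ, orderSimplex n σ) = 1 := by
    rw [← hcube]
    refine le_antisymm (measure_mono ?_) ?_
    · refine Set.iUnion_subset fun σ u hu => ?_
      simpa using hu.1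
    · rw [← measure_sdiff_null (volume_integralWalls n)]
      refine measure_mono fun u hu => ?_
      have hne : ∀ i j, i ≠ j → u i ≠ u j := by
        intro i j hij hu'
        apply hu.2
        rcases lt_or_gt_of_ne hij with h | h
        · exact ⟨i.succ, j.succ, by simpa using h, 0, by simp [hu']⟩
        · exact ⟨j.succ, i.succ, by simpa using h, 0, by simp [hu']⟩
      obtain ⟨σ, hσ⟩ := exists_perm_lt_iff (fun i j => u i < u j) (fun i => lt_irrefl _)
        (fun i j k => lt_trans) (fun i j hij => lt_or_gt_of_ne (hne i j hij))
      refine Set.mem_iUnion.mpr ⟨σ, ?_, fun i j => (hσ i j).mp⟩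
      simpa using hu.1
  rw [measure_iUnion hdisj (measurableSet_orderSimplex n), tsum_fintype,
    Finset.sum_congr rfl fun τ _ => (volume_orderSimplex_eq n τ).trans
      (volume_orderSimplex_eq n σ).symm] at hunion
  simp only [Finset.sum_const, Finset.card_univ, Fintype.card_perm, Fintype.card_fin,
    nsmul_eq_mul] at hunion
  exact ENNReal.eq_inv_of_mul_eq_one_left ((mul_comm _ _).trans hunion)

/-- The alcove with address `k`, in position coordinates. -/
def positionAlcove (n : ℕ) (k : PosRoot n → ℤ) : Set (Fin n → ℝ) :=
  {y | ∀ (i j : Fin (n + 1)) (h : i < j),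
    (k ⟨(i, j), h⟩ : ℝ) < extendZero y j - extendZero y i ∧
      extendZero y j - extendZero y i < k ⟨(i, j), h⟩ + 1}

lemma measurableSet_positionAlcove (n : ℕ) (k : PosRoot n → ℤ) :
    MeasurableSet (positionAlcove n k) := by
  apply IsOpen.measurableSet
  simp only [positionAlcove, Set.ofPred_and, Set.ofPred_forall]
  refine isOpen_iInter_of_finite fun i => isOpen_iInter_of_finite fun j =>
      isOpen_iInter_of_finite fun _ => IsOpen.inter ?_ ?_
  · exact isOpen_lt continuous_const ((continuous_extendZero j).sub (continuous_extendZero i))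
  · exact isOpen_lt ((continuous_extendZero j).sub (continuous_extendZero i)) continuous_const

lemma volume_positionAlcove {n : ℕ} {k : PosRoot n → ℤ} (hk : Shi n k) :
    volume (positionAlcove n k) = (n.factorial : ENNReal)⁻¹ := by
  let m : Fin n → ℤ := fun i => k ⟨(0, i.succ), Fin.succ_pos i⟩
  let K : ∀ i j : Fin n, i < j → ℤ := fun i j h =>
    k ⟨(i.succ, j.succ), Fin.succ_lt_succ_iff.mpr h⟩
  have h0 : ∀ i j (h : i < j), m i + K i j h ≤ m j ∧ m j ≤ m i + K i j h + 1 := fun i j h =>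
    hk 0 i.succ j.succ (Fin.succ_pos i) (Fin.succ_lt_succ_iff.mpr h)
  have h1 : ∀ i t j (h : i < t) (h' : t < j), K i t h + K t j h' ≤ K i j (h.trans h') ∧
      K i j (h.trans h') ≤ K i t h + K t j h' + 1 := fun i t j h h' =>
    hk i.succ t.succ j.succ (Fin.succ_lt_succ_iff.mpr h) (Fin.succ_lt_succ_iff.mpr h')
  -- the order in which the fractional parts of the positions must appear
  let r : Fin n → Fin n → Prop := fun i j =>
    (∃ h : i < j, K i j h = m j - m i) ∨ ∃ h : j < i, K j i h = m i - m j - 1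
  obtain ⟨σ, hσ⟩ := exists_perm_lt_iff r
    (by rintro i (⟨h, -⟩ | ⟨h, -⟩) <;> exact lt_irrefl _ h)
    (by
      rintro i j l (⟨h, e⟩ | ⟨h, e⟩) (⟨h', e'⟩ | ⟨h', e'⟩)
      · left
        refine ⟨h.trans h', ?_⟩
        have := h1 _ _ _ h h'
        have := h0 _ _ (h.trans h')
        omega
      · rcases lt_trichotomy i l with hil | rfl | hil
        · left
          refine ⟨hil, ?_⟩
          have := h1 _ _ _ hil h'
          have := h0 _ _ hil
          omega
        · omega
        · right
          refine ⟨hil, ?_⟩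
          have := h1 _ _ _ hil h
          have := h0 _ _ hil
          omega
      · rcases lt_trichotomy i l with hil | rfl | hil
        · left
          refine ⟨hil, ?_⟩
          have := h1 _ _ _ h hil
          have := h0 _ _ hil
          omega
        · omega
        · right
          refine ⟨hil, ?_⟩
          have := h1 _ _ _ h' hil
          have := h0 _ _ hil
          omega
      · right
        refine ⟨h'.trans h, ?_⟩
        have := h1 _ _ _ h' h
        have := h0 _ _ (h'.trans h)
        omega)
    (by
      intro i j hij
      rcases lt_or_gt_of_ne hij with h | h
      · have := h0 _ _ h
        by_cases e : K i j h = m j - m i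
        · exact Or.inl (Or.inl ⟨h, e⟩)
        · exact Or.inr (Or.inr ⟨h, by omega⟩)
      · have := h0 _ _ h
        by_cases e : K j i h = m i - m j
        · exact Or.inr (Or.inl ⟨h, e⟩)
        · exact Or.inl (Or.inr ⟨h, by omega⟩))
  rw [← volume_orderSimplex n σ, ← measure_preimage_add_right volume (fun i => -(m i : ℝ)) (orderSimplex n σ)]
  congr 1
  ext y
  simp only [positionAlcove, orderSimplex, Set.mem_ofPred_eq, Set.mem_preimage, Pi.add_apply, hσ]
  constructor
  · intro hy
    refine ⟨fun i => ?_, fun i j => ?_⟩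
    · have := hy 0 i.succ (Fin.succ_pos i)
      simp only [extendZero_succ, extendZero_zero] at this
      change (m i : ℝ) < _ ∧ _ < (m i : ℝ) + 1 at this
      constructor <;> linarith
    · rintro (⟨h, e⟩ | ⟨h, e⟩)
      · have := (hy _ _ (Fin.succ_lt_succ_iff.mpr h)).1
        change (K i j h : ℝ) < _ at this
        rw [e] at this
        push_cast at this
        simp only [extendZero_succ] at this
        linarith
      · have := (hy _ _ (Fin.succ_lt_succ_iff.mpr h)).2
        change _ < (K j i h : ℝ) + 1 at this
        rw [e] at this
        push_cast at this
        simp only [extendZero_succ] at this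
        linarith
  · rintro ⟨hy, hr⟩ i j h
    obtain ⟨j, rfl⟩ := Fin.exists_succ_eq.mpr (Fin.ne_zero_of_lt h)
    revert h
    refine Fin.cases (fun h => ?_) (fun i h => ?_) i
    · have := hy j
      change (m j : ℝ) < _ ∧ _ < (m j : ℝ) + 1
      simp only [extendZero_succ, extendZero_zero]
      constructor <;> linarith
    · have hij : i < j := Fin.succ_lt_succ_iff.mp h
      change (K i j hij : ℝ) < _ ∧ _ < (K i j hij : ℝ) + 1
      simp only [extendZero_succ]
      have hi := hy i
      have hj := hy j
      by_cases e : K i j hij = m j - m i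
      · have := hr i j (Or.inl ⟨hij, e⟩)
        rw [e]
        push_cast
        constructor <;> linarith
      · have e' : K i j hij = m j - m i - 1 := by
          have := h0 _ _ hij
          omega
        have := hr j i (Or.inr ⟨hij, e'⟩)
        rw [e']
        push_cast
        constructor <;> linarith

lemma simpleRoot_mem_rootIdeal {n : ℕ} (π : Equiv.Perm (Fin (n + 1))) (j : Fin n) :
    (⟨(j.castSucc, j.succ), Fin.castSucc_lt_succ⟩ : PosRoot n) ∈ rootIdeal n π := by
  by_contra hmem
  have hno : ∀ c : Fin n, ((π c.castSucc : ℕ) ≤ j ↔ (π c.succ : ℕ) ≤ j) := by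
    intro c
    by_contra hc
    apply hmem
    refine ⟨c, ?_⟩
    simp only [Fin.val_castSucc, Fin.val_succ]
    omega
  have hall : ∀ i : Fin (n + 1), ((π i : ℕ) ≤ j ↔ (π 0 : ℕ) ≤ j) := by
    intro i
    induction i using Fin.induction with
    | zero => rfl
    | succ i ih => exact (hno i).symm.trans ih
  have a := hall (π.symm j.castSucc)
  have b := hall (π.symm j.succ)
  simp only [Equiv.apply_symm_apply, Fin.val_castSucc, Fin.val_succ] at a b
  omega

lemma addrSet_finite (n : ℕ) (π : Equiv.Perm (Fin (n + 1))) : (addrSet n π).Finite := by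
  have : Finite (PosRoot n) := Subtype.finite
  refine (Set.Finite.pi' fun _ : PosRoot n => Set.finite_Icc (0 : ℤ) n).subset ?_
  rintro k ⟨hk0, hk, hI⟩ p
  refine ⟨hk0 p, ?_⟩
  have key : ∀ (j : Fin (n + 1)) (i : Fin (n + 1)) (h : i < j),
      k ⟨(i, j), h⟩ ≤ (j : ℕ) := by
    intro j
    induction j using Fin.induction with
    | zero => intro i h; exact absurd h (Fin.not_lt_zero i)
    | succ j ih =>
      intro i h
      have hs := hI _ (simpleRoot_mem_rootIdeal π j)
      rcases (Fin.le_castSucc_iff.mpr h).eq_or_lt with rfl | h'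
      · rw [hs]; positivity
      · have h1 := (hk i j.castSucc j.succ h' Fin.castSucc_lt_succ).2
        have h2 := ih i h'
        rw [hs] at h1
        simp only [Fin.val_castSucc, Fin.val_succ] at *
        push_cast
        omega
  obtain ⟨⟨i, j⟩, h⟩ := p
  refine (key j i h).trans ?_
  have := j.is_lt
  omega

/-- The polytope of sorted positions `y` for which the walk with ordinal pattern `π` has all
steps in `[-1, 1]`. -/
def positionPolytope (n : ℕ) (π : Equiv.Perm (Fin (n + 1))) : Set (Fin n → ℝ) :=
  {y | StrictMono (extendZero y) ∧ ∀ i : Fin n,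
    -1 ≤ extendZero y (π i.succ) - extendZero y (π i.castSucc) ∧
      extendZero y (π i.succ) - extendZero y (π i.castSucc) ≤ 1}

lemma stepMap_preimage (n : ℕ) (π : Equiv.Perm (Fin (n + 1))) :
    stepMap n π ⁻¹' (D n π ∩ {x | ∀ i, -1 ≤ x i ∧ x i ≤ 1}) = positionPolytope n π := by
  ext y
  have hD : stepMap n π y ∈ D n π ↔ StrictMono (extendZero y) := by
    simp only [D, Set.mem_ofPred_eq, walk_stepMap, sub_lt_sub_iff_right, ne_eq, sub_left_inj]
    constructor
    · rintro ⟨-, h⟩ a b hab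
      have := (h (π.symm a) (π.symm b)).mpr (by simpa using hab)
      simpa using this
    · intro h
      exact ⟨fun i j hij e => hij (π.injective (h.injective e)), fun i j => h.lt_iff_lt⟩
  rw [Set.mem_preimage, Set.mem_inter_iff, hD]
  simp only [positionPolytope, Set.mem_ofPred_eq,
    stepMap_apply]

lemma iUnion_positionAlcove_subset (n : ℕ) (π : Equiv.Perm (Fin (n + 1))) :
    ⋃ k ∈ addrSet n π, positionAlcove n k ⊆ positionPolytope n π := by
  refine Set.iUnion₂_subset fun k hk y hy => ?_
  obtain ⟨hk0, -, hI⟩ := hk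
  refine ⟨fun i j h => ?_, fun c => ?_⟩
  · have h1 := (hy i j h).1
    have h2 : (0 : ℝ) ≤ k ⟨(i, j), h⟩ := by exact_mod_cast hk0 _
    linarith
  · have hne : π c.castSucc ≠ π c.succ := fun e =>
      (Fin.castSucc_lt_succ (i := c)).ne (π.injective e)
    rcases lt_or_gt_of_ne hne with h | h
    · have hz := hI ⟨(π c.castSucc, π c.succ), h⟩ ⟨c, min_le_left _ _, le_max_right _ _⟩
      have := hy _ _ h
      rw [hz] at this
      push_cast at this
      constructor <;> linarith
    · have hz := hI ⟨(π c.succ, π c.castSucc), h⟩ ⟨c, min_le_right _ _, le_max_left _ _⟩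
      have := hy _ _ h
      rw [hz] at this
      push_cast at this
      constructor <;> linarith

lemma positionPolytope_diff_subset (n : ℕ) (π : Equiv.Perm (Fin (n + 1))) :
    positionPolytope n π \ integralWalls n ⊆ ⋃ k ∈ addrSet n π, positionAlcove n k := by
  rintro y ⟨⟨hmono, hstep⟩, hw⟩
  let k : PosRoot n → ℤ := fun p => ⌊extendZero y p.1.2 - extendZero y p.1.1⌋
  refine Set.mem_iUnion₂.mpr ⟨k, ⟨fun p => ?_, fun i t j hit htj => ?_, fun p hp => ?_⟩,
    fun i j h => ⟨?_, Int.lt_floor_add_one _⟩⟩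
  · exact Int.floor_nonneg.mpr (sub_nonneg.mpr (hmono p.2).le)
  · have e : extendZero y j - extendZero y i =
      (extendZero y t - extendZero y i) + (extendZero y j - extendZero y t) := by ring
    change ⌊_⌋ + ⌊_⌋ ≤ ⌊_⌋ ∧ ⌊_⌋ ≤ ⌊_⌋ + ⌊_⌋ + 1
    dsimp only
    rw [e]
    exact ⟨Int.le_floor_add _ _, by
      linarith [Int.le_floor_add_floor (extendZero y t - extendZero y i)
        (extendZero y j - extendZero y t)]⟩
  · obtain ⟨⟨i, j⟩, hij⟩ := p
    obtain ⟨c, h1, h2⟩ := hp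
    have hlt := hmono hij
    have hle : extendZero y j - extendZero y i ≤ 1 := by
      have hc := hstep c
      dsimp only at h1 h2
      rcases le_total (π c.castSucc : ℕ) (π c.succ : ℕ) with h | h
      · rw [min_eq_left h] at h1
        rw [max_eq_right h] at h2
        have ha := hmono.monotone (Fin.le_def.mpr h1)
        have hb := hmono.monotone (Fin.le_def.mpr h2)
        linarith
      · rw [min_eq_right h] at h1
        rw [max_eq_left h] at h2
        have ha := hmono.monotone (Fin.le_def.mpr h1)
        have hb := hmono.monotone (Fin.le_def.mpr h2)
        linarith
    have hne : extendZero y j - extendZero y i ≠ 1 := fun e =>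
      hw ⟨i, j, hij, 1, by simpa using e⟩
    exact Int.floor_eq_zero_iff.mpr ⟨sub_nonneg.mpr hlt.le, lt_of_le_of_ne hle hne⟩
  · exact lt_of_le_of_ne (Int.floor_le _) fun e => hw ⟨i, j, h, _, e.symm⟩

lemma volume_positionPolytope (n : ℕ) (π : Equiv.Perm (Fin (n + 1))) :
    volume (positionPolytope n π) = (addrSet n π).ncard * (n.factorial : ENNReal)⁻¹ := by
  have h : volume (positionPolytope n π) =
      volume (⋃ k ∈ addrSet n π, positionAlcove n k) := by
    refine le_antisymm ?_ (measure_mono (iUnion_positionAlcove_subset n π))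
    rw [← measure_sdiff_null (volume_integralWalls n)]
    exact measure_mono (positionPolytope_diff_subset n π)
  have hfin := addrSet_finite n π
  have hdisj : (addrSet n π).PairwiseDisjoint (positionAlcove n) := by
    intro k _ l _ hne
    refine Set.disjoint_left.mpr fun y hk hl => hne ?_
    ext ⟨⟨i, j⟩, hij⟩
    have a := hk i j hij
    have b := hl i j hij
    have h1 : (k ⟨(i, j), hij⟩ : ℝ) < l ⟨(i, j), hij⟩ + 1 := by linarith
    have h2 : (l ⟨(i, j), hij⟩ : ℝ) < k ⟨(i, j), hij⟩ + 1 := by linarith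
    norm_cast at h1 h2
    omega
  have hset : (⋃ k ∈ addrSet n π, positionAlcove n k) =
      ⋃ k ∈ hfin.toFinset, positionAlcove n k := by simp
  rw [h, hset, measure_biUnion_finset (by simpa using hdisj)
    fun k _ => measurableSet_positionAlcove n k,
    Finset.sum_congr rfl fun k hk => volume_positionAlcove (hfin.mem_toFinset.mp hk).2.1,
    Finset.sum_const, nsmul_eq_mul, Set.ncard_eq_toFinset_card _ hfin]

lemma measurableSet_steps (n : ℕ) :
    MeasurableSet {x : Fin n → ℝ | ∀ i, -1 ≤ x i ∧ x i ≤ 1} := by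
  have : {x : Fin n → ℝ | ∀ i, -1 ≤ x i ∧ x i ≤ 1} =
      Set.univ.pi fun _ => Set.Icc (-1 : ℝ) 1 := by
    ext; simp only [Set.mem_univ_pi, Set.mem_Icc, Set.mem_ofPred_eq]
  rw [this]
  exact MeasurableSet.univ_pi fun _ => measurableSet_Icc

/-- for the uniform density on `[-1,1]`, `P(f,π) = |S|/(2^n n!)` where `S`
is the set of nonnegative Shi addresses vanishing on `I_π`. -/
theorem stmt_13 (n : ℕ) (hn : 1 ≤ n) (π : Equiv.Perm (Fin (n + 1))) :
    (addrSet n π).Finite ∧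
    ∫ x in D n π, ∏ i : Fin n, (if -1 ≤ x i ∧ x i ≤ 1 then (1 : ℝ) / 2 else 0) =
      ((addrSet n π).ncard : ℝ) / (2 ^ n * (n.factorial : ℝ)) := by
  refine ⟨addrSet_finite n π, ?_⟩
  have hprod : ∀ x : Fin n → ℝ,
      ∏ i : Fin n, (if -1 ≤ x i ∧ x i ≤ 1 then (1 : ℝ) / 2 else 0) =
        Set.indicator {x : Fin n → ℝ | ∀ i, -1 ≤ x i ∧ x i ≤ 1} (fun _ => (1 / 2 : ℝ) ^ n) x := by
    intro x
    by_cases hx : ∀ i, -1 ≤ x i ∧ x i ≤ 1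
    · rw [Set.indicator_of_mem (by exact hx), Finset.prod_congr rfl fun i _ => if_pos (hx i)]
      simp
    · rw [Set.indicator_of_notMem (by exact hx)]
      obtain ⟨i, hi⟩ := not_forall.mp hx
      exact Finset.prod_eq_zero (Finset.mem_univ i) (if_neg hi)
  simp only [hprod]
  rw [setIntegral_indicator (measurableSet_steps n), setIntegral_const, measureReal_def,
    ← volume_preimage_stepMap n π, stepMap_preimage, volume_positionPolytope]
  simp only [ENNReal.toReal_mul, ENNReal.toReal_natCast, ENNReal.toReal_inv, smul_eq_mul]
  rw [one_div, inv_pow]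
  field_simp
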